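/- For real constants c₁ ≠ 0 and c₂, the function f(u,v) = (c₁c₂ − uv)/√(v² − c₁²), defined on the open set where v² > c₁², satisfies the PDE f·(f_uu·f_vv − f_uv²) − [(1 − f_v²)·f_uu + 2·f_u·f_v·f_uv + (1 − f_u²)·f_vv] = 0 on its domain. -/

import Mathlib

/-- Partial derivative in the first variable. -/
noncomputable def pd1 (f : ℝ → ℝ → ℝ) (u v : ℝ) : ℝ := deriv (fun t => f t v) u

/-- Partial derivative in the second variable. -/
noncomputable def pd2 (f : ℝ → ℝ → ℝ) (u v : ℝ) : ℝ := deriv (fun t => f u t) v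

/-- Equation (6.2): the PDE for graphs in the upper half-space model of S₁³
with conformal normal Gauss map, at the point (u, v). -/
noncomputable def deSitterPDE (f : ℝ → ℝ → ℝ) (u v : ℝ) : Prop :=
  f u v * (pd1 (pd1 f) u v * pd2 (pd2 f) u v - pd2 (pd1 f) u v ^ 2) -
    ((1 - pd2 f u v ^ 2) * pd1 (pd1 f) u v +
      2 * pd1 f u v * pd2 f u v * pd2 (pd1 f) u v +
      (1 - pd1 f u v ^ 2) * pd2 (pd2 f) u v) = 0

lemma aux_sqrt (a v : ℝ) (hv : a ^ 2 < v ^ 2) :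
    HasDerivAt (fun t : ℝ => Real.sqrt (t ^ 2 - a ^ 2)) (v / Real.sqrt (v ^ 2 - a ^ 2)) v := by
  have h1 : HasDerivAt (fun t : ℝ => t ^ 2 - a ^ 2) (2 * v) v := by
    simpa using (hasDerivAt_pow 2 v).sub_const (a ^ 2)
  have h2 := h1.sqrt (by linarith : (0:ℝ) < v ^ 2 - a ^ 2).ne'
  convert h2 using 1
  rw [mul_div_mul_left _ _ (two_ne_zero)]

lemma aux_pd1 (k a u v : ℝ) :
    pd1 (fun u v => (k - u * v) / Real.sqrt (v ^ 2 - a ^ 2)) u v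
      = -v / Real.sqrt (v ^ 2 - a ^ 2) := by
  unfold pd1
  have h : HasDerivAt (fun t : ℝ => (k - t * v) / Real.sqrt (v ^ 2 - a ^ 2))
      (-(1 * v) / Real.sqrt (v ^ 2 - a ^ 2)) u :=
    (((hasDerivAt_id u).mul_const v).const_sub k).div_const _
  rw [h.deriv, one_mul]

lemma aux_pd2 (k a u v : ℝ) (hv : a ^ 2 < v ^ 2) :
    pd2 (fun u v => (k - u * v) / Real.sqrt (v ^ 2 - a ^ 2)) u v
      = (a ^ 2 * u - k * v) / Real.sqrt (v ^ 2 - a ^ 2) ^ 3 := by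
  unfold pd2
  have hp : 0 < Real.sqrt (v ^ 2 - a ^ 2) := Real.sqrt_pos.2 (by linarith)
  have hs : Real.sqrt (v ^ 2 - a ^ 2) ^ 2 = v ^ 2 - a ^ 2 := Real.sq_sqrt (by linarith)
  have h : HasDerivAt (fun t : ℝ => (k - u * t) / Real.sqrt (t ^ 2 - a ^ 2)) _ v :=
    (((hasDerivAt_id v).const_mul u).const_sub k).div (aux_sqrt a v hv) hp.ne'
  rw [h.deriv]
  simp only [id]
  generalize Real.sqrt (v ^ 2 - a ^ 2) = s at *
  field_simp
  linear_combination (-u) * hs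

/-- Corollary in Section 7: f(u,v) = (c₁c₂ − uv)/√(v² − c₁²) solves (6.2)
on the open set where v² > c₁². -/
theorem stmt_10 (c₁ c₂ : ℝ) (hc : c₁ ≠ 0) (u v : ℝ) (hv : c₁ ^ 2 < v ^ 2) :
    deSitterPDE (fun u v => (c₁ * c₂ - u * v) / Real.sqrt (v ^ 2 - c₁ ^ 2)) u v := by
  unfold deSitterPDE
  generalize c₁ * c₂ = k
  have hp : 0 < Real.sqrt (v ^ 2 - c₁ ^ 2) := Real.sqrt_pos.2 (by linarith)
  have hs : Real.sqrt (v ^ 2 - c₁ ^ 2) ^ 2 = v ^ 2 - c₁ ^ 2 := Real.sq_sqrt (by linarith)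
  have e1 : pd1 (fun u v => (k - u * v) / Real.sqrt (v ^ 2 - c₁ ^ 2))
      = fun _ v => -v / Real.sqrt (v ^ 2 - c₁ ^ 2) := by
    funext x y; exact aux_pd1 k c₁ x y
  have e11 : pd1 (fun _ v => -v / Real.sqrt (v ^ 2 - c₁ ^ 2)) u v = 0 := by
    simp [pd1]
  have e12 : pd2 (fun _ v => -v / Real.sqrt (v ^ 2 - c₁ ^ 2)) u v
      = c₁ ^ 2 / Real.sqrt (v ^ 2 - c₁ ^ 2) ^ 3 := by
    have := aux_pd2 0 c₁ 1 v hv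
    simpa [pd2] using this
  have e22 : pd2 (pd2 (fun u v => (k - u * v) / Real.sqrt (v ^ 2 - c₁ ^ 2))) u v
      = (2 * k * v ^ 2 + k * c₁ ^ 2 - 3 * c₁ ^ 2 * u * v)
        / Real.sqrt (v ^ 2 - c₁ ^ 2) ^ 5 := by
    have ev : (fun t => pd2 (fun u v => (k - u * v) / Real.sqrt (v ^ 2 - c₁ ^ 2)) u t)
        =ᶠ[nhds v] fun t => (c₁ ^ 2 * u - k * t) / Real.sqrt (t ^ 2 - c₁ ^ 2) ^ 3 := by
      have ho : IsOpen {t : ℝ | c₁ ^ 2 < t ^ 2} :=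
        isOpen_lt continuous_const (continuous_pow 2)
      filter_upwards [ho.mem_nhds hv] with t ht
      exact aux_pd2 k c₁ u t ht
    have h : HasDerivAt (fun t : ℝ => (c₁ ^ 2 * u - k * t) / Real.sqrt (t ^ 2 - c₁ ^ 2) ^ 3) _ v :=
      (((hasDerivAt_id v).const_mul k).const_sub (c₁ ^ 2 * u)).div
        ((aux_sqrt c₁ v hv).pow 3) (pow_ne_zero 3 hp.ne')
    rw [pd2, ev.deriv_eq, h.deriv]
    simp only [id]
    generalize Real.sqrt (v ^ 2 - c₁ ^ 2) = s at *
    field_simp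
    push_cast
    norm_num
    linear_combination (-k * s ^ 2) * hs
  rw [e1, e11, e12, e22, aux_pd2 k c₁ u v hv]
  clear e1 e11 e12 e22
  beta_reduce
  generalize Real.sqrt (v ^ 2 - c₁ ^ 2) = s at *
  have h1 : 1 - (-v / s) ^ 2 = - c₁ ^ 2 / s ^ 2 := by
    field_simp
    linear_combination hs
  rw [h1]
  field_simp
  ring
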